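/- Meyer's theorem implication: a quadratic space over ℚ of signature (n,2) with n ≥ 3 is isotropic, i.e., contains a nonzero vector x with Q(x) = 0. -/

import Mathlib

open Module

/-- The quadratic character at `p` of the prime-to-`p` part of `n`. -/
def unitChar (p : ℕ) (n : ℤ) : ℤ := jacobiSym (n / (p : ℤ) ^ padicValInt p n) p

/-- The tame Hilbert symbol at an odd prime `p`. -/
def tameSymbol (p : ℕ) (a b : ℤ) : ℤ :=
  jacobiSym (-1) p ^ (padicValInt p a * padicValInt p b) *
    unitChar p a ^ padicValInt p b * unitChar p b ^ padicValInt p a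

theorem Int.exists_eq_prime_pow_mul {p : ℕ} (hp : p.Prime) {n : ℤ} (hn : n ≠ 0) :
    ∃ (k : ℕ) (m : ℤ), n = (p : ℤ) ^ k * m ∧ ¬ (p : ℤ) ∣ m := by
  have hfin : FiniteMultiplicity (p : ℤ) n :=
    Int.finiteMultiplicity_iff.2 ⟨by simpa using hp.ne_one, hn⟩
  obtain ⟨m, hm, hd⟩ := hfin.exists_eq_pow_mul_and_not_dvd
  exact ⟨_, m, hm, hd⟩

theorem padicValInt_prime_pow_mul {p : ℕ} (hp : p.Prime) (k : ℕ) {m : ℤ} (hm : ¬ (p : ℤ) ∣ m) :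
    padicValInt p ((p : ℤ) ^ k * m) = k := by
  have := Fact.mk hp
  have hp0 : (p : ℤ) ≠ 0 := by exact_mod_cast hp.ne_zero
  have hm0 : m ≠ 0 := by rintro rfl; simp at hm
  rw [padicValInt.mul (pow_ne_zero _ hp0) hm0, padicValInt.eq_zero_of_not_dvd hm]
  simp [padicValInt, Int.natAbs_pow]

theorem unitChar_prime_pow_mul {p : ℕ} (hp : p.Prime) (k : ℕ) {m : ℤ} (hm : ¬ (p : ℤ) ∣ m) :
    unitChar p ((p : ℤ) ^ k * m) = jacobiSym m p := by
  have hp0 : (p : ℤ) ≠ 0 := by exact_mod_cast hp.ne_zero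
  rw [unitChar, padicValInt_prime_pow_mul hp k hm,
    Int.mul_ediv_cancel_left _ (pow_ne_zero _ hp0)]

theorem tameSymbol_prime_pow_mul {p : ℕ} (hp : p.Prime) (k l : ℕ) {m n : ℤ}
    (hm : ¬ (p : ℤ) ∣ m) (hn : ¬ (p : ℤ) ∣ n) :
    tameSymbol p ((p : ℤ) ^ k * m) ((p : ℤ) ^ l * n) =
      jacobiSym (-1) p ^ (k * l) * jacobiSym m p ^ l * jacobiSym n p ^ k := by
  simp only [tameSymbol, padicValInt_prime_pow_mul hp _ hm, padicValInt_prime_pow_mul hp _ hn,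
    unitChar_prime_pow_mul hp _ hm, unitChar_prime_pow_mul hp _ hn]

theorem tameSymbol_comm (p : ℕ) (a b : ℤ) : tameSymbol p a b = tameSymbol p b a := by
  simp only [tameSymbol, Nat.mul_comm (padicValInt p a)]
  ring

theorem tameSymbol_mul_left {p : ℕ} (hp : p.Prime) {a b c : ℤ} (ha : a ≠ 0) (hb : b ≠ 0)
    (hc : c ≠ 0) : tameSymbol p (a * b) c = tameSymbol p a c * tameSymbol p b c := by
  obtain ⟨i, a, rfl, ha'⟩ := Int.exists_eq_prime_pow_mul hp ha
  obtain ⟨j, b, rfl, hb'⟩ := Int.exists_eq_prime_pow_mul hp hb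
  obtain ⟨k, c, rfl, hc'⟩ := Int.exists_eq_prime_pow_mul hp hc
  have hab : ¬ (p : ℤ) ∣ a * b := fun h =>
    ((Nat.prime_iff_prime_int.1 hp).dvd_or_dvd h).elim ha' hb'
  rw [show (p : ℤ) ^ i * a * (p ^ j * b) = p ^ (i + j) * (a * b) by ring,
    tameSymbol_prime_pow_mul hp _ _ hab hc', tameSymbol_prime_pow_mul hp _ _ ha' hc',
    tameSymbol_prime_pow_mul hp _ _ hb' hc', jacobiSym.mul_left]
  ring

theorem jacobiSym_eq_one_or_of_not_dvd {p : ℕ} (hp : p.Prime) {m : ℤ} (hm : ¬ (p : ℤ) ∣ m) :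
    jacobiSym m p = 1 ∨ jacobiSym m p = -1 := by
  apply jacobiSym.eq_one_or_neg_one
  rw [Int.gcd_comm]
  exact Int.isCoprime_iff_gcd_eq_one.1
    ((Prime.coprime_iff_not_dvd (Nat.prime_iff_prime_int.1 hp)).2 hm)

theorem jacobiSym_neg_one_left_eq (p : ℕ) : jacobiSym (-1) p = 1 ∨ jacobiSym (-1) p = -1 :=
  jacobiSym.eq_one_or_neg_one (by simp)

theorem pow_eq_one_of_even_of_eq_or {x : ℤ} (hx : x = 1 ∨ x = -1) {k : ℕ} (hk : Even k) :
    x ^ k = 1 := by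
  rcases hx with rfl | rfl
  · simp
  · exact hk.neg_one_pow

theorem tameSymbol_eq_one_or {p : ℕ} (hp : p.Prime) {a b : ℤ} (ha : a ≠ 0) (hb : b ≠ 0) :
    tameSymbol p a b = 1 ∨ tameSymbol p a b = -1 := by
  obtain ⟨i, a, rfl, ha'⟩ := Int.exists_eq_prime_pow_mul hp ha
  obtain ⟨j, b, rfl, hb'⟩ := Int.exists_eq_prime_pow_mul hp hb
  rw [tameSymbol_prime_pow_mul hp _ _ ha' hb']
  have h : ∀ x : ℤ, x = 1 ∨ x = -1 → ∀ k : ℕ, x ^ k = 1 ∨ x ^ k = -1 := by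
    rintro x (rfl | rfl) k
    · simp
    · exact neg_one_pow_eq_or ℤ k
  rcases h _ (jacobiSym_neg_one_left_eq p) (i * j) with h1 | h1 <;>
  rcases h _ (jacobiSym_eq_one_or_of_not_dvd hp ha') j with h2 | h2 <;>
  rcases h _ (jacobiSym_eq_one_or_of_not_dvd hp hb') i with h3 | h3 <;>
  simp [h1, h2, h3]

theorem tameSymbol_of_even {p : ℕ} (hp : p.Prime) {k l : ℕ} (hk : Even k) (hl : Even l) {m n : ℤ}
    (hm : ¬ (p : ℤ) ∣ m) (hn : ¬ (p : ℤ) ∣ n) :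
    tameSymbol p ((p : ℤ) ^ k * m) ((p : ℤ) ^ l * n) = 1 := by
  rw [tameSymbol_prime_pow_mul hp _ _ hm hn,
    pow_eq_one_of_even_of_eq_or (jacobiSym_neg_one_left_eq p) (hk.mul_right l),
    pow_eq_one_of_even_of_eq_or (jacobiSym_eq_one_or_of_not_dvd hp hm) hl,
    pow_eq_one_of_even_of_eq_or (jacobiSym_eq_one_or_of_not_dvd hp hn) hk]
  norm_num

theorem tameSymbol_of_not_dvd {p : ℕ} (hp : p.Prime) {m n : ℤ}
    (hm : ¬ (p : ℤ) ∣ m) (hn : ¬ (p : ℤ) ∣ n) : tameSymbol p m n = 1 := by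
  simpa using tameSymbol_of_even hp (k := 0) (l := 0) (by simp) (by simp) hm hn

theorem tameSymbol_sq_mul_right {p : ℕ} (hp : p.Prime) {a b c : ℤ} (ha : a ≠ 0) (hb : b ≠ 0)
    (hc : c ≠ 0) : tameSymbol p a (c ^ 2 * b) = tameSymbol p a b := by
  rw [tameSymbol_comm, pow_two, tameSymbol_mul_left hp (mul_ne_zero hc hc) hb ha,
    tameSymbol_mul_left hp hc hc ha, tameSymbol_comm p b a]
  rcases tameSymbol_eq_one_or hp hc ha with h | h <;> simp [h]

/-- If a unit is congruent to a square modulo `p`, its quadratic character is trivial. -/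
theorem jacobiSym_eq_one_of_dvd_sq_sub {p : ℕ} (hp : p.Prime) {m t : ℤ} (hm : ¬ (p : ℤ) ∣ m)
    (h : (p : ℤ) ∣ t ^ 2 - m) : jacobiSym m p = 1 := by
  have ht : ¬ (p : ℤ) ∣ t := fun ht => hm (by
    have := dvd_sub (dvd_pow ht two_ne_zero) h
    simpa using this)
  rw [jacobiSym.mod_left' (Int.emod_eq_emod_iff_emod_sub_eq_zero.2
    (Int.emod_eq_zero_of_dvd h)).symm]
  rcases jacobiSym_eq_one_or_of_not_dvd hp ht with h | h <;> simp [jacobiSym.pow_left, h]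

/-- The tame symbol of `(a, b)` is trivial when `a + b` is a square. -/
theorem tameSymbol_eq_one_of_add_eq_sq {p : ℕ} (hp : p.Prime) {a b t : ℤ} (ha : a ≠ 0)
    (hb : b ≠ 0) (h : a + b = t ^ 2) : tameSymbol p a b = 1 := by
  have hp0 : (p : ℤ) ≠ 0 := by exact_mod_cast hp.ne_zero
  have hpI := Nat.prime_iff_prime_int.1 hp
  have key : ∀ (i d : ℕ) (a b t : ℤ), ¬ (p : ℤ) ∣ a → ¬ (p : ℤ) ∣ b →
      (p : ℤ) ^ i * a + p ^ (i + (d + 1)) * b = t ^ 2 →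
      tameSymbol p (p ^ i * a) (p ^ (i + (d + 1)) * b) = 1 := by
    intro i d a b t ha hb h
    have h' : t ^ 2 = p ^ i * (a + p * (p ^ d * b)) := by rw [← h]; ring
    have ha' : ¬ (p : ℤ) ∣ a + p * (p ^ d * b) := fun hh =>
      ha ((dvd_add_left (dvd_mul_right _ _)).1 hh)
    have ht : t ≠ 0 := by
      rintro rfl
      rcases mul_eq_zero.1 (h'.symm.trans (by norm_num)) with h0 | h0
      · exact pow_ne_zero _ hp0 h0
      · exact ha' (h0 ▸ dvd_zero _)
    obtain ⟨k, s, rfl, hs⟩ := Int.exists_eq_prime_pow_mul hp ht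
    have hs2 : ¬ (p : ℤ) ∣ s ^ 2 := fun hh => hs (hpI.dvd_of_dvd_pow hh)
    have hik : k * 2 = i := by
      rw [← padicValInt_prime_pow_mul hp (k * 2) hs2, ← padicValInt_prime_pow_mul hp i ha', ← h']
      congr 1; ring
    have hsa : s ^ 2 = a + p * (p ^ d * b) := by
      apply mul_left_cancel₀ (pow_ne_zero i hp0)
      rw [← h', ← hik]; ring
    have h1 : jacobiSym a p = 1 :=
      jacobiSym_eq_one_of_dvd_sq_sub hp ha (t := s) ⟨p ^ d * b, by rw [hsa]; ring⟩
    have hi : Even i := ⟨k, by omega⟩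
    rw [tameSymbol_prime_pow_mul hp _ _ ha hb, h1,
      pow_eq_one_of_even_of_eq_or (jacobiSym_neg_one_left_eq p) (hi.mul_right _),
      pow_eq_one_of_even_of_eq_or (jacobiSym_eq_one_or_of_not_dvd hp hb) hi]
    simp
  obtain ⟨i, a, rfl, ha'⟩ := Int.exists_eq_prime_pow_mul hp ha
  obtain ⟨j, b, rfl, hb'⟩ := Int.exists_eq_prime_pow_mul hp hb
  rcases lt_trichotomy i j with hij | rfl | hij
  · obtain ⟨d, rfl⟩ := Nat.exists_eq_add_of_lt hij
    exact key i d a b t ha' hb' h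
  · rcases Nat.even_or_odd i with hi | ⟨r, hr⟩
    · exact tameSymbol_of_even hp hi hi ha' hb'
    · have hd : (p : ℤ) ∣ a + b := by
        have h' : t ^ 2 = p ^ i * (a + b) := by rw [← h]; ring
        by_contra hd
        have ht : t ≠ 0 := by
          rintro rfl
          rcases mul_eq_zero.1 (h'.symm.trans (by norm_num)) with h0 | h0
          · exact pow_ne_zero _ hp0 h0
          · exact hd (h0 ▸ dvd_zero _)
        obtain ⟨k, s, rfl, hs⟩ := Int.exists_eq_prime_pow_mul hp ht
        have hs2 : ¬ (p : ℤ) ∣ s ^ 2 := fun hh => hs (hpI.dvd_of_dvd_pow hh)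
        have : k * 2 = i := by
          rw [← padicValInt_prime_pow_mul hp (k * 2) hs2, ← padicValInt_prime_pow_mul hp i hd, ← h']
          congr 1; ring
        omega
      have hab : ¬ (p : ℤ) ∣ -1 * a * b := fun hh => by
        rcases hpI.dvd_or_dvd hh with hh | hh
        · exact ha' (by simpa using hh)
        · exact hb' hh
      have h1 : jacobiSym (-1 * a * b) p = 1 :=
        jacobiSym_eq_one_of_dvd_sq_sub hp hab (t := a)
          ((show a ^ 2 - -1 * a * b = (a + b) * a by ring) ▸ hd.mul_right a)
      rw [jacobiSym.mul_left, jacobiSym.mul_left] at h1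
      have hodd : Odd i := ⟨r, hr⟩
      rw [tameSymbol_prime_pow_mul hp _ _ ha' hb']
      have hpow : ∀ x : ℤ, x = 1 ∨ x = -1 → ∀ n, Odd n → x ^ n = x := by
        rintro x (rfl | rfl) n hn
        · simp
        · exact hn.neg_one_pow
      rw [hpow _ (jacobiSym_neg_one_left_eq p) _ (hodd.mul hodd),
        hpow _ (jacobiSym_eq_one_or_of_not_dvd hp ha') _ hodd,
        hpow _ (jacobiSym_eq_one_or_of_not_dvd hp hb') _ hodd, h1]
  · obtain ⟨d, rfl⟩ := Nat.exists_eq_add_of_lt hij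
    rw [tameSymbol_comm]
    exact key j d b a t hb' ha' (by rw [← h]; ring)

theorem exists_dvd_sq_sub_of_squarefree {b : ℤ} (hb : Squarefree b) (a : ℤ)
    (h : ∀ p : ℕ, p.Prime → (p : ℤ) ∣ b → ∃ t : ℕ, (p : ℤ) ∣ (t : ℤ) ^ 2 - a) :
    ∃ t : ℤ, b ∣ t ^ 2 - a := by
  have h' : ∀ p : ℕ, ∃ t : ℕ, p.Prime → (p : ℤ) ∣ b → (p : ℤ) ∣ (t : ℤ) ^ 2 - a := by
    intro p
    by_cases hp : p.Prime ∧ (p : ℤ) ∣ b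
    · obtain ⟨t, ht⟩ := h p hp.1 hp.2
      exact ⟨t, fun _ _ => ht⟩
    · exact ⟨0, fun h1 h2 => (hp ⟨h1, h2⟩).elim⟩
  choose t ht using h'
  have hsq : Squarefree b.natAbs := Int.squarefree_natAbs.2 hb
  obtain ⟨k, hk⟩ := Nat.chineseRemainderOfFinset t id b.natAbs.primeFactors
    (fun p hp => (Nat.prime_of_mem_primeFactors hp).ne_zero)
    (fun p hp q hq hpq => (Nat.coprime_primes (Nat.prime_of_mem_primeFactors hp)
      (Nat.prime_of_mem_primeFactors hq)).2 hpq)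
  refine ⟨k, ?_⟩
  rw [← Int.natAbs_dvd, ← Nat.prod_primeFactors_of_squarefree hsq, Nat.cast_prod]
  refine Finset.prod_dvd_of_coprime ?_ ?_
  · intro p hp q hq hpq
    exact Nat.isCoprime_iff_coprime.2 ((Nat.coprime_primes (Nat.prime_of_mem_primeFactors hp)
      (Nat.prime_of_mem_primeFactors hq)).2 hpq)
  · intro p hp
    have h1 := ht p (Nat.prime_of_mem_primeFactors hp)
      (Int.natCast_dvd.2 (Nat.dvd_of_mem_primeFactors hp))
    have h2 : (p : ℤ) ∣ (k : ℤ) - t p := (Nat.modEq_iff_dvd.1 (hk p hp).symm)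
    have := dvd_add h1 (h2.mul_right (k + t p))
    convert this using 1
    ring

theorem Int.exists_dvd_sq_sub_of_jacobiSym {p : ℕ} (hp : p.Prime) {a : ℤ}
    (h : jacobiSym a p = 1) : ∃ t : ℕ, (p : ℤ) ∣ (t : ℤ) ^ 2 - a := by
  have := Fact.mk hp
  have hs : IsSquare (a : ZMod p) := by
    by_contra hs
    rw [ZMod.nonsquare_iff_jacobiSym_eq_neg_one.2 hs] at h
    norm_num at h
  obtain ⟨r, hr⟩ := hs
  refine ⟨r.val, ?_⟩
  rw [← ZMod.intCast_zmod_eq_zero_iff_dvd]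
  push_cast
  rw [ZMod.natCast_zmod_val, hr]
  ring

theorem Int.exists_dvd_sq_sub_two_mul_abs_le {a b : ℤ} (hb : b ≠ 0)
    (h : ∃ t : ℤ, b ∣ t ^ 2 - a) : ∃ t : ℤ, b ∣ t ^ 2 - a ∧ 2 * |t| ≤ |b| := by
  obtain ⟨t, ht⟩ := h
  have hpos : 0 < |b| := abs_pos.2 hb
  have h0 := Int.emod_nonneg t hpos.ne'
  have h1 := Int.emod_lt_of_pos t hpos
  have hd : b ∣ t - t % |b| := (abs_dvd b _).1 (Int.dvd_self_sub_emod)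
  have key : ∀ s : ℤ, b ∣ t - s → b ∣ s ^ 2 - a := fun s hs => by
    rw [show s ^ 2 - a = t ^ 2 - a - (t - s) * (t + s) by ring]
    exact dvd_sub ht (hs.mul_right (t + s))
  by_cases hle : 2 * (t % |b|) ≤ |b|
  · exact ⟨t % |b|, key _ hd, by rwa [abs_of_nonneg h0]⟩
  · refine ⟨t % |b| - |b|, key _ ?_, ?_⟩
    · rw [show t - (t % |b| - |b|) = t - t % |b| + |b| by ring]
      exact dvd_add hd ((dvd_abs b b).2 dvd_rfl)
    · rw [abs_of_neg (by linarith)]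
      linarith

/-- **Legendre's theorem** on ternary quadratic forms, in terms of tame symbols. -/
theorem exists_sq_eq_of_tameSymbol_eq_one (a b : ℤ) (ha : a ≠ 0) (hb : b ≠ 0)
    (hpos : 0 < a ∨ 0 < b) (h : ∀ p : ℕ, p.Prime → p ≠ 2 → tameSymbol p a b = 1) :
    ∃ x y z : ℤ, (x ≠ 0 ∨ y ≠ 0 ∨ z ≠ 0) ∧ z ^ 2 = a * x ^ 2 + b * y ^ 2 := by
  induction hN : a.natAbs + b.natAbs using Nat.strong_induction_on generalizing a b with
  | _ N ih =>
  subst hN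
  wlog hab : |a| ≤ |b| generalizing a b
  · obtain ⟨x, y, z, h0, h1⟩ := this b a hb ha hpos.symm
      (fun p hp hp2 => by rw [tameSymbol_comm]; exact h p hp hp2)
      (fun m hm a' b' => ih m (by omega) a' b') (le_of_not_ge hab)
    exact ⟨y, x, z, by tauto, by rw [h1]; ring⟩
  by_cases hsq : Squarefree b
  swap
  · obtain ⟨k, c, rfl, hk⟩ : ∃ k c : ℤ, b = k ^ 2 * c ∧ ¬ IsUnit k := by
      simp only [Squarefree, not_forall] at hsq
      obtain ⟨k, ⟨c, hc⟩, hk⟩ := hsq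
      exact ⟨k, c, by rw [hc]; ring, hk⟩
    have hk0 : k ≠ 0 := by rintro rfl; simp at hb
    have hc0 : c ≠ 0 := by rintro rfl; simp at hb
    have hlt : c.natAbs < (k ^ 2 * c).natAbs := by
      rw [Int.natAbs_mul, Int.natAbs_pow]
      have h1 : 1 < k.natAbs := by
        have : k.natAbs ≠ 1 := fun h => hk (Int.isUnit_iff_natAbs_eq.2 h)
        have := Int.natAbs_ne_zero.2 hk0
        omega
      have h2 : 0 < c.natAbs := Int.natAbs_pos.2 hc0
      exact lt_mul_of_one_lt_left h2 (Nat.one_lt_pow two_ne_zero h1)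
    obtain ⟨x, y, z, h0, h1⟩ := ih _ (by omega) a c ha hc0
      (hpos.imp_right fun h => pos_of_mul_pos_right h (sq_nonneg k))
      (fun p hp hp2 => by rw [← h p hp hp2, tameSymbol_sq_mul_right hp ha hc0 hk0]) rfl
    refine ⟨k * x, y, k * z, ?_, ?_⟩
    · rcases h0 with h0 | h0 | h0
      · exact Or.inl (mul_ne_zero hk0 h0)
      · exact Or.inr (Or.inl h0)
      · exact Or.inr (Or.inr (mul_ne_zero hk0 h0))
    · linear_combination k ^ 2 * h1
  by_cases hb1 : |b| ≤ 1
  · have ha1 : |a| ≤ 1 := hab.trans hb1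
    rw [abs_le] at ha1 hb1
    rcases hpos with hpos | hpos
    · obtain rfl : a = 1 := by omega
      exact ⟨1, 0, 1, by simp, by ring⟩
    · obtain rfl : b = 1 := by omega
      exact ⟨0, 1, 1, by simp, by ring⟩
  obtain ⟨t, ⟨c, hc⟩, ht⟩ := Int.exists_dvd_sq_sub_two_mul_abs_le hb
    (exists_dvd_sq_sub_of_squarefree hsq a (by
      intro p hp hpb
      by_cases hpa : (p : ℤ) ∣ a
      · exact ⟨0, by simpa using hpa⟩
      by_cases hp2 : p = 2
      · subst hp2
        refine ⟨1, ?_⟩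
        push_cast at hpa ⊢
        omega
      apply Int.exists_dvd_sq_sub_of_jacobiSym hp
      obtain ⟨m, rfl⟩ := hpb
      have hpm : ¬ (p : ℤ) ∣ m := by
        rintro ⟨n, rfl⟩
        have := hsq p ⟨n, by ring⟩
        exact (Nat.prime_iff_prime_int.1 hp).not_isUnit this
      have h1 := tameSymbol_prime_pow_mul hp 0 1 hpa hpm
      simp only [pow_zero, one_mul, pow_one, mul_one] at h1
      rw [← h1, h p hp hp2]))
  by_cases hc0 : c = 0
  · subst hc0
    exact ⟨1, 0, t, by simp, by linear_combination hc⟩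
  have hlt : c.natAbs < b.natAbs := by
    zify
    by_contra! hle
    have h1 : |b| * |c| ≤ |t| ^ 2 + |a| := by
      rw [← abs_mul, ← hc, ← abs_pow]
      exact abs_sub _ _
    have := abs_nonneg t
    nlinarith
  have hpc : 0 < a ∨ 0 < c := by
    rcases lt_or_gt_of_ne ha with h1 | h1
    · right
      have hb' : 0 < b := hpos.resolve_left (by linarith)
      have : 0 < b * c := by rw [← hc]; nlinarith [sq_nonneg t]
      exact pos_of_mul_pos_right this hb'.le
    · exact Or.inl h1
  obtain ⟨x, y, z, h0, h1⟩ := ih _ (by omega) a c ha hc0 hpc (fun p hp hp2 => by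
    have h1 : tameSymbol p a (b * c) = 1 :=
      tameSymbol_eq_one_of_add_eq_sq hp ha (mul_ne_zero hb hc0) (t := t) (by rw [← hc]; ring)
    rw [tameSymbol_comm, tameSymbol_mul_left hp hb hc0 ha, tameSymbol_comm p b,
      h p hp hp2, one_mul] at h1
    rw [tameSymbol_comm, h1]) rfl
  by_cases hy : y = 0
  · subst hy
    exact ⟨x, 0, z, h0, by linear_combination h1⟩
  · exact ⟨z + t * x, c * y, t * z + a * x, Or.inr (Or.inl (mul_ne_zero hc0 hy)), by
      linear_combination (t ^ 2 - a) * h1 + c * y ^ 2 * hc⟩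

/-- `n` lies in the square class of `ℚ_[2]` of the odd integers congruent to `r` modulo `8`. -/
def TwoAdicClass (r n : ℤ) : Prop := ∃ (k : ℕ) (m : ℤ), n = 2 ^ (2 * k) * m ∧ m % 8 = r

/-- The Hilbert symbol at `2` of `2 ^ k * m` and `2 ^ j * s`, up to factors
independent of `k`, for `m` and `s` odd. -/
def dyadicSymbol (k : ℕ) (m : ZMod 8) (j : ℕ) (s : ZMod 8) : ℤ :=
  ZMod.χ₈ s ^ k * ZMod.χ₈ m ^ j * if m = 1 ∨ m = 5 then 1 else ZMod.χ₈' s * ZMod.χ₈ s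

theorem jacobiSym_two_pow_mul {k j s : ℕ} {m : ℤ} (hm : Odd m) (hs : Odd s)
    (h : m ∣ s * 2 ^ j - 1) :
    jacobiSym (2 ^ k * m) s = dyadicSymbol k m j s := by
  have hχ : ∀ x : ZMod 8, ZMod.χ₈' x * ZMod.χ₈ x = ZMod.χ₄ (x.val : ZMod 4) := by decide
  have hχs : ZMod.χ₈' s * ZMod.χ₈ s = ZMod.χ₄ (s : ZMod 4) := by
    rw [hχ, ZMod.val_natCast, ← ZMod.natCast_mod (s % 8) 4, Nat.mod_mod_of_dvd s (by norm_num),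
      ZMod.natCast_mod]
  have hn : ∀ n : ℕ, Odd n → (n : ℤ) ∣ s * 2 ^ j - 1 →
      jacobiSym n s = ZMod.χ₈ (n : ZMod 8) ^ j * if n % 4 = 1 then 1 else ZMod.χ₄ (s : ZMod 4) := by
    intro n hn hd
    have h1 : jacobiSym s n * jacobiSym 2 n ^ j = 1 := by
      rw [← jacobiSym.pow_left, ← jacobiSym.mul_left, jacobiSym.mod_left'
        (Int.emod_eq_emod_iff_emod_sub_eq_zero.2 (Int.emod_eq_zero_of_dvd hd)),
        jacobiSym.one_left]
    have h2 : jacobiSym s n = jacobiSym 2 n ^ j := by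
      have h3 : jacobiSym 2 n = 1 ∨ jacobiSym 2 n = -1 := by
        apply jacobiSym.eq_one_or_neg_one
        exact Nat.coprime_two_left.2 hn
      rcases h3 with h3 | h3 <;> rw [h3] at h1 ⊢
      · simpa using h1
      · rcases neg_one_pow_eq_or ℤ j with h4 | h4 <;> rw [h4] at h1 ⊢ <;> linarith
    rw [← jacobiSym.at_two hn, ← h2]
    rcases Nat.odd_mod_four_iff.1 (Nat.odd_iff.1 hn) with h4 | h4
    · simp [h4, jacobiSym.quadratic_reciprocity_one_mod_four h4 hs]
    · rcases Nat.odd_mod_four_iff.1 (Nat.odd_iff.1 hs) with h5 | h5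
      · simp [h4, ← jacobiSym.quadratic_reciprocity_one_mod_four h5 hn,
          ZMod.χ₄_nat_one_mod_four h5]
      · simp [h4, jacobiSym.quadratic_reciprocity_three_mod_four h4 h5,
          ZMod.χ₄_nat_three_mod_four h5]
  have hm8 : ∀ n : ℕ, Odd n → ((n : ZMod 8) = 1 ∨ (n : ZMod 8) = 5 ↔ n % 4 = 1) := by
    intro n hn
    have h1 := ZMod.natCast_eq_natCast_iff n 1 8
    have h5 := ZMod.natCast_eq_natCast_iff n 5 8
    push_cast at h1 h5
    rw [h1, h5, Nat.ModEq, Nat.ModEq]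
    omega
  rw [jacobiSym.mul_left, jacobiSym.pow_left, jacobiSym.at_two hs, dyadicSymbol, hχs]
  obtain ⟨n, rfl | rfl⟩ := m.eq_nat_or_neg
  · have hno : Odd n := by exact_mod_cast hm
    simp only [Int.cast_natCast, hn n hno h, hm8 n hno]
    ring
  · have hno : Odd n := by simpa using hm
    rw [← neg_one_mul, jacobiSym.mul_left, jacobiSym.at_neg_one hs, hn n hno (by simpa using h)]
    have h8 : ZMod.χ₈ (-(n : ZMod 8)) = ZMod.χ₈ (n : ZMod 8) := by
      generalize (n : ZMod 8) = x
      revert x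
      decide
    have hneg : (-(n : ZMod 8) = 1 ∨ -(n : ZMod 8) = 5) ↔ ¬ n % 4 = 1 := by
      rw [← hm8 n hno]
      have : (n : ZMod 8) = 1 ∨ (n : ZMod 8) = 3 ∨ (n : ZMod 8) = 5 ∨ (n : ZMod 8) = 7 := by
        have h1 := ZMod.natCast_eq_natCast_iff n 1 8
        have h3 := ZMod.natCast_eq_natCast_iff n 3 8
        have h5 := ZMod.natCast_eq_natCast_iff n 5 8
        have h7 := ZMod.natCast_eq_natCast_iff n 7 8
        push_cast at h1 h3 h5 h7
        rw [h1, h3, h5, h7]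
        simp only [Nat.ModEq]
        have := Nat.odd_iff.1 hno
        omega
      rcases this with h | h | h | h <;> rw [h] <;> decide
    push_cast
    rw [neg_one_mul, h8]
    simp only [hneg]
    have h4 : ZMod.χ₄ (s : ZMod 4) * ZMod.χ₄ (s : ZMod 4) = 1 := by
      rcases Nat.odd_mod_four_iff.1 (Nat.odd_iff.1 hs) with h5 | h5
      · simp [ZMod.χ₄_nat_one_mod_four h5]
      · simp [ZMod.χ₄_nat_three_mod_four h5]
    by_cases hc : n % 4 = 1
    · simp only [hc, not_true_eq_false, if_true, if_false]; ring
    · simp only [hc, not_false_eq_true, if_true, if_false]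
      linear_combination (ZMod.χ₈ (s : ZMod 8) ^ k * ZMod.χ₈ (n : ZMod 8) ^ j) * h4

theorem exists_dyadicSymbol_eq : ∀ (k₁ k₂ : Fin 2) (m₁ m₂ : Fin 4),
    ¬ (k₁ = 0 ∧ m₁ = 0) → ¬ (k₂ = 0 ∧ m₂ = 0) → ¬ (k₁ = k₂ ∧ m₁ = m₂) → ∀ e₁ e₂ : Fin 2,
    ∃ (j : Fin 2) (s : Fin 4),
      dyadicSymbol k₁ (2 * m₁.val + 1 : ℕ) j (2 * s.val + 1 : ℕ) = (-1) ^ e₁.val ∧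
      dyadicSymbol k₂ (2 * m₂.val + 1 : ℕ) j (2 * s.val + 1 : ℕ) = (-1) ^ e₂.val := by
  decide

/-- `n` is a nonzero square in `ℚ_[p]`, for `p` an odd prime. -/
def IsPadicSquare (p : ℕ) (n : ℤ) : Prop :=
  ∃ (k : ℕ) (m : ℤ), n = (p : ℤ) ^ (2 * k) * m ∧ jacobiSym m p = 1

theorem not_dvd_of_jacobiSym_ne_zero {p : ℕ} (hp : p.Prime) {m : ℤ} (h : jacobiSym m p ≠ 0) :
    ¬ (p : ℤ) ∣ m := by
  intro hd
  apply h
  rw [jacobiSym.eq_zero_iff]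
  refine ⟨hp.ne_zero, fun h1 => ?_⟩
  have := Int.dvd_coe_gcd hd (dvd_refl (p : ℤ))
  rw [h1] at this
  exact hp.one_lt.ne' (by exact_mod_cast Int.eq_one_of_dvd_one (by positivity) this)

theorem exists_jacobiSym_eq_neg_one {p : ℕ} (hp : p.Prime) (hp2 : p ≠ 2) :
    ∃ w : ℕ, jacobiSym w p = -1 := by
  have := Fact.mk hp
  obtain ⟨a, ha⟩ := FiniteField.exists_nonsquare (F := ZMod p) (by simpa [ZMod.ringChar_zmod_n])
  refine ⟨a.val, ZMod.nonsquare_iff_jacobiSym_eq_neg_one.2 ?_⟩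
  simpa using ha

theorem exists_local_exponents {e y₁ y₂ c₁ c₂ : ℤ} {k₁ k₂ : ℕ} (he : e = 1 ∨ e = -1)
    (hy₁ : y₁ = 1 ∨ y₁ = -1) (hy₂ : y₂ = 1 ∨ y₂ = -1) (hc₁ : c₁ = 1 ∨ c₁ = -1)
    (hc₂ : c₂ = 1 ∨ c₂ = -1) (h₁ : Even k₁ → y₁ = 1 → c₁ = 1) (h₂ : Even k₂ → y₂ = 1 → c₂ = 1)
    (h : ¬ (Even (k₁ + k₂) ∧ y₁ * y₂ = 1)) :
    ∃ i j : ℕ, e ^ (i * k₁) * ((-1) ^ j) ^ k₁ * y₁ ^ i = c₁ ∧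
      e ^ (i * k₂) * ((-1) ^ j) ^ k₂ * y₂ ^ i = c₂ := by
  have key : ∃ i j : Fin 2, e ^ (i.val * k₁) * ((-1) ^ j.val) ^ k₁ * y₁ ^ i.val = c₁ ∧
      e ^ (i.val * k₂) * ((-1) ^ j.val) ^ k₂ * y₂ ^ i.val = c₂ := by
    simp only [Nat.even_add] at h
    simp only [Fin.exists_fin_two, Fin.val_zero, Fin.val_one, zero_mul, one_mul, pow_zero, pow_one,
      one_pow, mul_one]
    rcases Nat.even_or_odd k₁ with hk₁ | hk₁ <;> rcases Nat.even_or_odd k₂ with hk₂ | hk₂ <;>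
    rcases he with rfl | rfl <;> rcases hy₁ with rfl | rfl <;> rcases hy₂ with rfl | rfl <;>
    rcases hc₁ with rfl | rfl <;> rcases hc₂ with rfl | rfl <;>
    solve
    | simp [hk₁.neg_one_pow, hk₂.neg_one_pow]
    | simp [hk₁] at h₁
    | simp [hk₂] at h₂
    | simp [hk₁, hk₂] at h
    | simp [Nat.not_even_iff_odd.2 hk₁, Nat.not_even_iff_odd.2 hk₂] at h
  obtain ⟨i, j, h⟩ := key
  exact ⟨i, j, h⟩

theorem tameSymbol_eq_one_of_isPadicSquare {p : ℕ} (hp : p.Prime) {k : ℕ} {m a : ℤ} (ha : a ≠ 0)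
    (hk : Even k) (hm : jacobiSym m p = 1) : tameSymbol p a ((p : ℤ) ^ k * m) = 1 := by
  obtain ⟨i, a, rfl, ha'⟩ := Int.exists_eq_prime_pow_mul hp ha
  rw [tameSymbol_prime_pow_mul hp _ _ ha'
    (not_dvd_of_jacobiSym_ne_zero hp (by rw [hm]; exact one_ne_zero)), hm,
    pow_eq_one_of_even_of_eq_or (jacobiSym_neg_one_left_eq p) (hk.mul_left i),
    pow_eq_one_of_even_of_eq_or (jacobiSym_eq_one_or_of_not_dvd hp ha') hk]
  simp

theorem exists_tameSymbol_eq_one {p : ℕ} (hp : p.Prime) (hp2 : p ≠ 2) {d₁ d₂ m₁ m₂ : ℤ}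
    (hd₁ : d₁ ≠ 0) (hd₂ : d₂ ≠ 0) (hm₁ : m₁ ≠ 0) (hm₂ : m₂ ≠ 0)
    (h : ¬ IsPadicSquare p (d₁ * d₂)) :
    ∃ i r : ℕ, ¬ p ∣ r ∧ tameSymbol p (m₁ * (p ^ i * r : ℕ)) d₁ = 1 ∧
      tameSymbol p (m₂ * (p ^ i * r : ℕ)) d₂ = 1 := by
  have hc₁ := tameSymbol_eq_one_or hp hm₁ hd₁
  have hc₂ := tameSymbol_eq_one_or hp hm₂ hd₂
  obtain ⟨k₁, u₁, rfl, hu₁⟩ := Int.exists_eq_prime_pow_mul hp hd₁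
  obtain ⟨k₂, u₂, rfl, hu₂⟩ := Int.exists_eq_prime_pow_mul hp hd₂
  obtain ⟨w, hw⟩ := exists_jacobiSym_eq_neg_one hp hp2
  have hwp : ¬ (p : ℤ) ∣ w := not_dvd_of_jacobiSym_ne_zero hp (by rw [hw]; norm_num)
  obtain ⟨i, j, h₁, h₂⟩ := exists_local_exponents (jacobiSym_neg_one_left_eq p)
    (jacobiSym_eq_one_or_of_not_dvd hp hu₁) (jacobiSym_eq_one_or_of_not_dvd hp hu₂) hc₁ hc₂
    (tameSymbol_eq_one_of_isPadicSquare hp hm₁) (tameSymbol_eq_one_of_isPadicSquare hp hm₂)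
    (fun ⟨⟨k, hk⟩, hu⟩ => h ⟨k, u₁ * u₂, by rw [two_mul, ← hk]; ring,
      by rw [jacobiSym.mul_left, hu]⟩)
  have hwj : ¬ (p : ℤ) ∣ ((w ^ j : ℕ) : ℤ) := by
    intro hd
    push_cast at hd
    exact hwp ((Nat.prime_iff_prime_int.1 hp).dvd_of_dvd_pow hd)
  have hT0 : ((p ^ i * w ^ j : ℕ) : ℤ) ≠ 0 := by
    have hw0 : w ≠ 0 := by rintro rfl; simp at hwp
    exact_mod_cast mul_ne_zero (pow_ne_zero _ hp.ne_zero) (pow_ne_zero _ hw0)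
  have key : ∀ (k : ℕ) (u m : ℤ), m ≠ 0 → ¬ (p : ℤ) ∣ u → (p : ℤ) ^ k * u ≠ 0 →
      (tameSymbol p m (p ^ k * u) = 1 ∨ tameSymbol p m (p ^ k * u) = -1) →
      jacobiSym (-1) p ^ (i * k) * ((-1) ^ j) ^ k * jacobiSym u p ^ i =
        tameSymbol p m (p ^ k * u) →
      tameSymbol p (m * (p ^ i * w ^ j : ℕ)) (p ^ k * u) = 1 := by
    intro k u m hm hu hd hs he
    rw [tameSymbol_mul_left hp hm hT0 hd]
    have : tameSymbol p (p ^ i * w ^ j : ℕ) (p ^ k * u) = tameSymbol p m (p ^ k * u) := by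
      rw [← he, Nat.cast_mul, Nat.cast_pow p,
        tameSymbol_prime_pow_mul hp _ _ hwj hu, Nat.cast_pow, jacobiSym.pow_left, hw]
    rw [this]
    rcases hs with hs | hs <;> rw [hs] <;> norm_num
  exact ⟨i, w ^ j, by exact_mod_cast hwj, key k₁ u₁ m₁ hm₁ hu₁ hd₁ hc₁ h₁,
    key k₂ u₂ m₂ hm₂ hu₂ hd₂ hc₂ h₂⟩

theorem TwoAdicClass.of_even {k : ℕ} (hk : Even k) {m r : ℤ} (hm : m % 8 = r) :
    TwoAdicClass r (2 ^ k * m) := by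
  obtain ⟨j, rfl⟩ := hk
  exact ⟨j, m, by rw [two_mul], hm⟩

theorem ZMod.exists_natCast_of_odd {m : ℤ} (hm : Odd m) :
    ∃ i : Fin 4, (m : ZMod 8) = (2 * i.val + 1 : ℕ) ∧ m % 8 = 2 * (i.val : ℤ) + 1 := by
  have h2 := Int.odd_iff.1 hm
  refine ⟨⟨(m % 8 / 2).toNat, by omega⟩, ?_, ?_⟩
  · rw [← Int.cast_natCast, ZMod.intCast_eq_intCast_iff]
    simp only [Int.ModEq]
    push_cast
    omega
  · simp only
    omega

theorem dyadicSymbol_mod_two (k j : ℕ) {m s : ZMod 8} (hs : ZMod.χ₈ s = 1 ∨ ZMod.χ₈ s = -1) :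
    dyadicSymbol k m j s = dyadicSymbol (k % 2) m j s := by
  rw [dyadicSymbol, dyadicSymbol]
  conv_lhs => rw [← Nat.div_add_mod k 2, pow_add,
    pow_eq_one_of_even_of_eq_or hs (even_two_mul _), one_mul]

/-- Any pair of signs is attained by the dyadic symbols of two independent classes. -/
theorem exists_dyadicSymbol_eq_of_not_twoAdicClass {k₁ k₂ : ℕ} {m₁ m₂ e₁ e₂ : ℤ}
    (hm₁ : Odd m₁) (hm₂ : Odd m₂) (h₁ : ¬ TwoAdicClass 1 (2 ^ k₁ * m₁))
    (h₂ : ¬ TwoAdicClass 1 (2 ^ k₂ * m₂))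
    (h : ¬ TwoAdicClass 1 (2 ^ k₁ * m₁ * (2 ^ k₂ * m₂)))
    (he₁ : e₁ = 1 ∨ e₁ = -1) (he₂ : e₂ = 1 ∨ e₂ = -1) :
    ∃ j s : ℕ, Odd s ∧ dyadicSymbol k₁ m₁ j s = e₁ ∧ dyadicSymbol k₂ m₂ j s = e₂ := by
  obtain ⟨i₁, hi₁, hi₁'⟩ := ZMod.exists_natCast_of_odd hm₁
  obtain ⟨i₂, hi₂, hi₂'⟩ := ZMod.exists_natCast_of_odd hm₂
  have he : ∀ e : ℤ, e = 1 ∨ e = -1 → ∃ f : Fin 2, e = (-1) ^ f.val := by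
    rintro e (rfl | rfl)
    · exact ⟨0, by simp⟩
    · exact ⟨1, by simp⟩
  obtain ⟨f₁, rfl⟩ := he _ he₁
  obtain ⟨f₂, rfl⟩ := he _ he₂
  have hχ : ∀ s : Fin 4, ZMod.χ₈ ((2 * s.val + 1 : ℕ) : ZMod 8) = 1 ∨
    ZMod.χ₈ ((2 * s.val + 1 : ℕ) : ZMod 8) = -1 := by decide
  have hcls : ∀ (k : ℕ) (m : ℤ) (i : Fin 4), m % 8 = 2 * (i.val : ℤ) + 1 →
      ¬ TwoAdicClass 1 (2 ^ k * m) →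
      ¬ ((⟨k % 2, Nat.mod_lt _ two_pos⟩ : Fin 2) = 0 ∧ i = 0) := by
    rintro k m i hi hk ⟨h0, rfl⟩
    refine hk (TwoAdicClass.of_even (Nat.even_iff.2 ?_) (by simpa using hi))
    simpa [Fin.ext_iff] using h0
  obtain ⟨j, s, hj₁, hj₂⟩ := exists_dyadicSymbol_eq ⟨k₁ % 2, Nat.mod_lt _ two_pos⟩
    ⟨k₂ % 2, Nat.mod_lt _ two_pos⟩ i₁ i₂ (hcls _ _ _ hi₁' h₁) (hcls _ _ _ hi₂' h₂) (by
      rintro ⟨hk, rfl⟩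
      apply h
      rw [show (2 : ℤ) ^ k₁ * m₁ * (2 ^ k₂ * m₂) = 2 ^ (k₁ + k₂) * (m₁ * m₂) by ring]
      refine TwoAdicClass.of_even (Nat.even_add.2 ?_) ?_
      · simp only [Fin.mk.injEq] at hk
        rw [Nat.even_iff, Nat.even_iff, hk]
      · rw [Int.mul_emod, hi₁', hi₂']
        have hsq : ∀ i : Fin 4, (2 * (i.val : ℤ) + 1) * (2 * (i.val : ℤ) + 1) % 8 = 1 := by
          decide
        exact hsq i₁) f₁ f₂
  refine ⟨j, 2 * s.val + 1, odd_two_mul_add_one _, ?_, ?_⟩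
  · rw [dyadicSymbol_mod_two _ _ (hχ s), hi₁, ← hj₁]
  · rw [dyadicSymbol_mod_two _ _ (hχ s), hi₂, ← hj₂]

theorem tameSymbol_eq_one_of_jacobiSym_eq_one {p : ℕ} (hp : p.Prime) {a b : ℤ} (ha : a ≠ 0)
    (hb : jacobiSym b p = 1) : tameSymbol p a b = 1 := by
  simpa using tameSymbol_eq_one_of_isPadicSquare hp (k := 0) ha (by simp) hb

theorem tameSymbol_congr_left {p : ℕ} (hp : p.Prime) (i : ℕ) {m n b : ℤ}
    (hm : ¬ (p : ℤ) ∣ m) (hn : ¬ (p : ℤ) ∣ n) (hb : b ≠ 0) (h : jacobiSym m p = jacobiSym n p) :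
    tameSymbol p ((p : ℤ) ^ i * m) b = tameSymbol p ((p : ℤ) ^ i * n) b := by
  obtain ⟨k, b, rfl, hb'⟩ := Int.exists_eq_prime_pow_mul hp hb
  rw [tameSymbol_prime_pow_mul hp _ _ hm hb', tameSymbol_prime_pow_mul hp _ _ hn hb', h]

/-- Two norm residue conditions, solvable locally at the odd primes and independent at `2`,
are solved simultaneously by a positive integer. -/
theorem exists_pos_forall_tameSymbol_eq_one {d₁ d₂ m₁ m₂ : ℤ}
    (hd₁ : d₁ ≠ 0) (hd₂ : d₂ ≠ 0) (hm₁ : m₁ ≠ 0) (hm₂ : m₂ ≠ 0)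
    (hloc : ∀ p : ℕ, p.Prime → p ≠ 2 → ∃ i r : ℕ, ¬ p ∣ r ∧
      tameSymbol p (m₁ * (p ^ i * r : ℕ)) d₁ = 1 ∧ tameSymbol p (m₂ * (p ^ i * r : ℕ)) d₂ = 1)
    (h₁ : ¬ TwoAdicClass 1 d₁) (h₂ : ¬ TwoAdicClass 1 d₂) (h₁₂ : ¬ TwoAdicClass 1 (d₁ * d₂)) :
    ∃ T : ℤ, 0 < T ∧ ∀ p : ℕ, p.Prime → p ≠ 2 →
      tameSymbol p (m₁ * T) d₁ = 1 ∧ tameSymbol p (m₂ * T) d₂ = 1 := by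
  classical
  have hloc' : ∀ p : ℕ, ∃ i r : ℕ, p.Prime → p ≠ 2 → ¬ p ∣ r ∧
      tameSymbol p (m₁ * (p ^ i * r : ℕ)) d₁ = 1 ∧
      tameSymbol p (m₂ * (p ^ i * r : ℕ)) d₂ = 1 := by
    intro p
    by_cases hp : p.Prime ∧ p ≠ 2
    · obtain ⟨i, r, h⟩ := hloc p hp.1 hp.2
      exact ⟨i, r, fun _ _ => h⟩
    · exact ⟨0, 0, fun h h' => (hp ⟨h, h'⟩).elim⟩
  choose i r hir using hloc'
  set N : ℕ := (m₁ * m₂ * d₁ * d₂).natAbs with hN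
  have hN0 : N ≠ 0 := Int.natAbs_ne_zero.2 (by positivity)
  have hdvdN : ∀ x : ℤ, x ∣ m₁ * m₂ * d₁ * d₂ → x.natAbs ∣ N := fun x hx =>
    Int.natAbs_dvd_natAbs.2 hx
  set S := N.primeFactors.erase 2 with hS
  have hSp : ∀ p ∈ S, p.Prime ∧ p ≠ 2 ∧ p ∣ N := fun p hp => by
    rw [hS, Finset.mem_erase, Nat.mem_primeFactors] at hp
    exact ⟨hp.2.1, hp.1, hp.2.2.1⟩
  have hnd : ∀ p : ℕ, p.Prime → p ≠ 2 → p ∉ S → ¬ p ∣ N := fun p hp hp2 hpS hd => hpS (by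
    rw [hS, Finset.mem_erase, Nat.mem_primeFactors]
    exact ⟨hp2, hp, hd, hN0⟩)
  let W : ℕ → ℕ := fun p => ∏ l ∈ S.erase p, l ^ i l
  have hW : ∀ p, p.Prime → ¬ p ∣ W p := by
    intro p hp hd
    obtain ⟨l, hl, hpl⟩ := (Nat.prime_iff.1 hp).exists_mem_finset_dvd hd
    rw [Finset.mem_erase] at hl
    exact hl.1 ((Nat.prime_dvd_prime_iff_eq hp (hSp l hl.2).1).1 (hp.dvd_of_dvd_pow hpl)).symm
  obtain ⟨r₁, hr₁⟩ := Nat.chineseRemainderOfFinset (fun p => if p = 2 then 1 else r p * W p) id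
    (insert 2 S) (by
      intro p hp
      rcases Finset.mem_insert.1 hp with rfl | hp
      · norm_num
      · exact (hSp p hp).1.ne_zero) (by
      have hpr : ∀ p ∈ insert 2 S, p.Prime := by
        intro p hp
        rcases Finset.mem_insert.1 hp with rfl | hp
        · exact Nat.prime_two
        · exact (hSp p hp).1
      intro p hp q hq hpq
      exact (Nat.coprime_primes (hpr p hp) (hpr q hq)).2 hpq)
  have hr₁odd : Odd r₁ := by
    have := hr₁ 2 (Finset.mem_insert_self _ _)
    simp only [if_true, id] at this
    exact Nat.odd_iff.2 this
  have hr₁S : ∀ p ∈ S, r₁ ≡ r p * W p [MOD p] := fun p hp => by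
    simpa [(hSp p hp).2.1] using hr₁ p (Finset.mem_insert_of_mem hp)
  have hr₁N : Nat.Coprime r₁ N := by
    refine Nat.coprime_of_dvd fun p hp hpr hpN => ?_
    by_cases hp2 : p = 2
    · subst hp2
      exact (Nat.not_even_iff_odd.2 hr₁odd) (even_iff_two_dvd.2 hpr)
    · by_cases hpS : p ∈ S
      · have := (hr₁S p hpS).dvd_iff (dvd_refl p)
        exact ((hp.dvd_mul.1 (this.1 hpr)).elim (hir p hp hp2).1 (hW p hp))
      · exact hnd p hp hp2 hpS hpN
  obtain ⟨v, O, hO, hvO⟩ := Nat.exists_eq_two_pow_mul_odd hN0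
  obtain ⟨k₁, u₁, hdu₁, hu₁⟩ := Int.exists_eq_prime_pow_mul Nat.prime_two hd₁
  obtain ⟨k₂, u₂, hdu₂, hu₂⟩ := Int.exists_eq_prime_pow_mul Nat.prime_two hd₂
  push_cast at hdu₁ hdu₂ hu₁ hu₂
  have hodd : ∀ u : ℤ, ¬ 2 ∣ u → Odd u := fun u hu => Int.not_even_iff_odd.1
    (fun h => hu (even_iff_two_dvd.1 h))
  have huO : ∀ u : ℤ, Odd u → u.natAbs ∣ N → u ∣ O := by
    intro u hu hd
    rw [hvO] at hd
    exact Int.natAbs_dvd.1 (Int.natCast_dvd_natCast.2 (Nat.Coprime.dvd_of_dvd_mul_left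
      (Nat.Coprime.pow_right v (Nat.coprime_two_right.2 (Int.natAbs_odd.2 hu))) hd))
  have hd₁N : d₁.natAbs ∣ N := hdvdN _ ⟨m₁ * m₂ * d₂, by ring⟩
  have hd₂N : d₂.natAbs ∣ N := hdvdN _ ⟨m₁ * m₂ * d₁, by ring⟩
  have hu₁O : u₁ ∣ O := huO _ (hodd _ hu₁)
    ((Int.natAbs_dvd_natAbs.2 ⟨2 ^ k₁, by rw [hdu₁]; ring⟩).trans hd₁N)
  have hu₂O : u₂ ∣ O := huO _ (hodd _ hu₂)
    ((Int.natAbs_dvd_natAbs.2 ⟨2 ^ k₂, by rw [hdu₂]; ring⟩).trans hd₂N)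
  have hcop : ∀ d : ℤ, d.natAbs ∣ N → jacobiSym d r₁ = 1 ∨ jacobiSym d r₁ = -1 := fun d hd =>
    jacobiSym.eq_one_or_neg_one (Nat.Coprime.coprime_dvd_left hd hr₁N.symm)
  obtain ⟨j, s₀, hs₀, hj₁, hj₂⟩ := exists_dyadicSymbol_eq_of_not_twoAdicClass (hodd _ hu₁)
    (hodd _ hu₂) (hdu₁ ▸ h₁) (hdu₂ ▸ h₂) (by rwa [← hdu₁, ← hdu₂]) (hcop d₁ hd₁N) (hcop d₂ hd₂N)
  obtain ⟨s, hs8, hsO⟩ := Nat.chineseRemainder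
    (show Nat.Coprime 8 O from Nat.Coprime.pow_left 3 (Nat.coprime_two_left.2 hO))
    s₀ (((O + 1) / 2) ^ j)
  have hsodd : Odd s := by
    rw [Nat.odd_iff] at hs₀ ⊢
    have : s % 8 = s₀ % 8 := hs8
    omega
  have hsj : s * 2 ^ j ≡ 1 [MOD O] := by
    refine (hsO.mul_right _).trans ?_
    rw [← mul_pow]
    have : (O + 1) / 2 * 2 = O + 1 := by
      obtain ⟨c, rfl⟩ := hO
      omega
    rw [this]
    have h1 : O + 1 ≡ 1 [MOD O] := by simp [Nat.ModEq]
    simpa using h1.pow j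
  have hsjd : (O : ℤ) ∣ s * 2 ^ j - 1 := by
    have := Nat.modEq_iff_dvd.1 hsj.symm
    push_cast at this
    exact this
  have hsO' : Nat.Coprime s O := by
    have : Nat.Coprime (s * 2 ^ j) O := by
      rw [Nat.Coprime, hsj.gcd_eq]
      simp
    exact this.coprime_mul_right
  have hs8' : (s : ZMod 8) = s₀ := (ZMod.natCast_eq_natCast_iff _ _ _).2 hs8
  have hds : ∀ (d u : ℤ) (k : ℕ), d = 2 ^ k * u → Odd u → u ∣ O →
      dyadicSymbol k u j s₀ = jacobiSym d r₁ → (jacobiSym d r₁ = 1 ∨ jacobiSym d r₁ = -1) →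
      jacobiSym d (r₁ * s) = 1 := by
    intro d u k hd hu huO h1 h2
    have : NeZero r₁ := ⟨hr₁odd.pos.ne'⟩
    have : NeZero s := ⟨hsodd.pos.ne'⟩
    have h3 : jacobiSym d s = jacobiSym d r₁ := by
      rw [← h1, ← hs8', hd, jacobiSym_two_pow_mul hu hsodd (huO.trans hsjd)]
    rw [jacobiSym.mul_right, h3]
    rcases h2 with h2 | h2 <;> rw [h2] <;> norm_num
  have hrN : Nat.Coprime (r₁ * s) (8 * N) := by
    have h2 : ∀ x : ℕ, Odd x → Nat.Coprime x 8 := fun x hx =>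
      Nat.Coprime.pow_right 3 (Nat.coprime_two_right.2 hx)
    refine Nat.Coprime.mul_left (Nat.Coprime.mul_right (h2 _ hr₁odd) hr₁N)
      (Nat.Coprime.mul_right (h2 _ hsodd) ?_)
    rw [hvO]
    exact Nat.Coprime.mul_right (Nat.Coprime.pow_right v (Nat.coprime_two_right.2 hsodd)) hsO'
  have : NeZero (8 * N) := ⟨by positivity⟩
  obtain ⟨q, hqN, hq, hqr⟩ := Nat.forall_exists_prime_gt_and_eq_mod
    ((ZMod.isUnit_iff_coprime _ _).2 hrN) (8 * N)
  have hqr' : q ≡ r₁ * s [MOD 8 * N] := (ZMod.natCast_eq_natCast_iff _ _ _).1 hqr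
  have hqN' : ¬ q ∣ N := fun h => by
    have := Nat.le_of_dvd (Nat.pos_of_ne_zero hN0) h
    omega
  have hqS : q ∉ S := fun h => hqN' (hSp q h).2.2
  have hqodd : Odd q := hq.odd_of_ne_two (by rintro rfl; omega)
  have hdq : ∀ d : ℤ, d.natAbs ∣ N → jacobiSym d (r₁ * s) = 1 → jacobiSym d q = 1 := by
    intro d hd h1
    rw [jacobiSym.mod_right d hqodd, ← h1, jacobiSym.mod_right d (hr₁odd.mul hsodd)]
    congr 1
    exact hqr'.of_dvd (Nat.mul_dvd_mul (by norm_num) hd)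
  have hd₁q := hdq d₁ hd₁N (hds d₁ u₁ k₁ hdu₁ (hodd _ hu₁) hu₁O hj₁ (hcop d₁ hd₁N))
  have hd₂q := hdq d₂ hd₂N (hds d₂ u₂ k₂ hdu₂ (hodd _ hu₂) hu₂O hj₂ (hcop d₂ hd₂N))
  have hT0 : 0 < 2 ^ j * (∏ l ∈ S, l ^ i l) * q := by
    have : 0 < ∏ l ∈ S, l ^ i l := Finset.prod_pos fun l hl => pow_pos (hSp l hl).1.pos _
    have := hq.pos
    positivity
  have hTZ : ((2 ^ j * (∏ l ∈ S, l ^ i l) * q : ℕ) : ℤ) ≠ 0 := by exact_mod_cast hT0.ne'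
  refine ⟨(2 ^ j * (∏ l ∈ S, l ^ i l) * q : ℕ), by exact_mod_cast hT0, fun p hp hp2 => ?_⟩
  by_cases hpq : p = q
  · subst hpq
    exact ⟨tameSymbol_eq_one_of_jacobiSym_eq_one hp (mul_ne_zero hm₁ hTZ) hd₁q,
      tameSymbol_eq_one_of_jacobiSym_eq_one hp (mul_ne_zero hm₂ hTZ) hd₂q⟩
  have hp2' : ¬ p ∣ 2 ^ j := fun h =>
    hp2 ((Nat.prime_dvd_prime_iff_eq hp Nat.prime_two).1 (hp.dvd_of_dvd_pow h))
  have hpq' : ¬ p ∣ q := fun h => hpq ((Nat.prime_dvd_prime_iff_eq hp hq).1 h)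
  by_cases hpS : p ∈ S
  · obtain ⟨hr, ht₁, ht₂⟩ := hir p hp hp2
    have hpO : p ∣ O := by
      have := (hSp p hpS).2.2
      rw [hvO] at this
      exact (hp.dvd_mul.1 this).resolve_left fun h =>
        hp2 ((Nat.prime_dvd_prime_iff_eq hp Nat.prime_two).1 (hp.dvd_of_dvd_pow h))
    have hTp : 2 ^ j * (∏ l ∈ S, l ^ i l) * q = p ^ i p * (2 ^ j * W p * q) := by
      rw [← Finset.mul_prod_erase S _ hpS]
      ring
    have hnd' : ¬ p ∣ 2 ^ j * W p * q :=
      hp.not_dvd_mul (hp.not_dvd_mul hp2' (hW p hp)) hpq'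
    have hmod : 2 ^ j * W p * q ≡ r p * (W p * W p) [MOD p] := by
      have h1 : q ≡ r₁ * s [MOD p] := hqr'.of_dvd ((hSp p hpS).2.2.mul_left 8)
      have h2 := hsj.of_dvd hpO
      calc 2 ^ j * W p * q ≡ 2 ^ j * W p * (r₁ * s) [MOD p] := h1.mul_left _
        _ = s * 2 ^ j * (W p * r₁) := by ring
        _ ≡ 1 * (W p * (r p * W p)) [MOD p] := h2.mul ((hr₁S p hpS).mul_left _)
        _ = r p * (W p * W p) := by ring
    have hj : jacobiSym (2 ^ j * W p * q : ℕ) p = jacobiSym (r p : ℕ) p := by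
      rw [jacobiSym.mod_left' (Int.natCast_modEq_iff.2 hmod), Nat.cast_mul, Nat.cast_mul,
        jacobiSym.mul_left, jacobiSym.mul_left]
      have hWz : ¬ (p : ℤ) ∣ W p := by exact_mod_cast hW p hp
      rcases jacobiSym_eq_one_or_of_not_dvd hp hWz with h | h <;> simp [h]
    have key : ∀ m d : ℤ, m ≠ 0 → d ≠ 0 → tameSymbol p (m * (p ^ i p * r p : ℕ)) d = 1 →
        tameSymbol p (m * (2 ^ j * (∏ l ∈ S, l ^ i l) * q : ℕ)) d = 1 := by
      intro m d hm hd h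
      have hr0 : ((p ^ i p * r p : ℕ) : ℤ) ≠ 0 := by
        have : r p ≠ 0 := fun h0 => hr (h0 ▸ dvd_zero _)
        exact_mod_cast mul_ne_zero (pow_ne_zero _ hp.ne_zero) this
      rw [tameSymbol_mul_left hp hm hTZ hd, hTp, Nat.cast_mul, Nat.cast_pow,
        tameSymbol_congr_left hp _ (by exact_mod_cast hnd') (by exact_mod_cast hr) hd hj,
        ← h, tameSymbol_mul_left hp hm hr0 hd, Nat.cast_mul (p ^ i p), Nat.cast_pow p]
    exact ⟨key _ _ hm₁ hd₁ ht₁, key _ _ hm₂ hd₂ ht₂⟩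
  · have hpN := hnd p hp hp2 hpS
    have hnot : ∀ x : ℤ, x ∣ m₁ * m₂ * d₁ * d₂ → ¬ (p : ℤ) ∣ x := fun x hx h =>
      hpN ((Int.natCast_dvd.1 h).trans (hdvdN x hx))
    have hpT : ¬ (p : ℤ) ∣ (2 ^ j * (∏ l ∈ S, l ^ i l) * q : ℕ) := by
      intro h
      have h := Int.natCast_dvd_natCast.1 h
      refine hp.not_dvd_mul (hp.not_dvd_mul hp2' fun h => ?_) hpq' h
      obtain ⟨l, hl, hpl⟩ := (Nat.prime_iff.1 hp).exists_mem_finset_dvd h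
      have := (Nat.prime_dvd_prime_iff_eq hp (hSp l hl).1).1 (hp.dvd_of_dvd_pow hpl)
      exact hpS (this ▸ hl)
    have hmT : ∀ m : ℤ, m ∣ m₁ * m₂ * d₁ * d₂ →
        ¬ (p : ℤ) ∣ m * (2 ^ j * (∏ l ∈ S, l ^ i l) * q : ℕ) := fun m hm h =>
      ((Nat.prime_iff_prime_int.1 hp).dvd_or_dvd h).elim (hnot m hm) hpT
    exact ⟨tameSymbol_of_not_dvd hp (hmT _ ⟨m₂ * d₁ * d₂, by ring⟩)
        (hnot _ ⟨m₁ * m₂ * d₂, by ring⟩),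
      tameSymbol_of_not_dvd hp (hmT _ ⟨m₁ * d₁ * d₂, by ring⟩)
        (hnot _ ⟨m₁ * m₂ * d₁, by ring⟩)⟩

theorem Prime.even_of_pow_mul_eq_pow_two_mul_mul {R : Type*} [CommRing R] [IsDomain R] {p : R}
    (hp : Prime p) {v k : ℕ} {m n : R} (hm : ¬ p ∣ m) (hn : ¬ p ∣ n)
    (h : p ^ v * m = p ^ (2 * k) * n) : Even v ∧ m = n := by
  have hv : v = 2 * k := by
    have h1 := emultiplicity_eq_coe.2 ⟨dvd_mul_right (p ^ v) m, fun hd => hm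
      ((mul_dvd_mul_iff_left (pow_ne_zero v hp.ne_zero)).1 (by rwa [← pow_succ]))⟩
    have h2 := emultiplicity_eq_coe.2 ⟨dvd_mul_right (p ^ (2 * k)) n, fun hd => hn
      ((mul_dvd_mul_iff_left (pow_ne_zero (2 * k) hp.ne_zero)).1 (by rwa [← pow_succ]))⟩
    rw [h, h2] at h1
    exact_mod_cast h1.symm
  subst hv
  exact ⟨even_two_mul k, mul_left_cancel₀ (pow_ne_zero _ hp.ne_zero) h⟩

theorem isPadicSquare_prime_pow_mul_iff {p : ℕ} (hp : p.Prime) {v : ℕ} {m : ℤ}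
    (hm : ¬ (p : ℤ) ∣ m) : IsPadicSquare p ((p : ℤ) ^ v * m) ↔ Even v ∧ jacobiSym m p = 1 := by
  constructor
  · rintro ⟨k, n, h, hn⟩
    obtain ⟨hv, rfl⟩ := (Nat.prime_iff_prime_int.1 hp).even_of_pow_mul_eq_pow_two_mul_mul hm
      (not_dvd_of_jacobiSym_ne_zero hp (by rw [hn]; exact one_ne_zero)) h
    exact ⟨hv, hn⟩
  · rintro ⟨⟨k, rfl⟩, h⟩
    exact ⟨k, m, by rw [two_mul], h⟩

theorem twoAdicClass_two_pow_mul_iff {v : ℕ} {m r : ℤ} (hm : Odd m) (hr : Odd r) :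
    TwoAdicClass r (2 ^ v * m) ↔ Even v ∧ m % 8 = r := by
  constructor
  · rintro ⟨k, n, h, hn⟩
    obtain ⟨hv, rfl⟩ := Int.prime_two.even_of_pow_mul_eq_pow_two_mul_mul
      (Int.two_dvd_ne_zero.2 (Int.odd_iff.1 hm)) (by rw [Int.odd_iff] at hr; omega) h
    exact ⟨hv, hn⟩
  · rintro ⟨hv, h⟩
    exact TwoAdicClass.of_even hv h

/-- Being a nonsquare in `ℚ_[p]` is an open condition. -/
theorem exists_forall_modEq_not_isPadicSquare {p : ℕ} (hp : p.Prime) {x₀ : ℤ} (hx₀ : x₀ ≠ 0)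
    (h : ¬ IsPadicSquare p x₀) :
    ∃ e : ℕ, ∀ x : ℤ, x ≡ x₀ [ZMOD (p : ℤ) ^ e] → ¬ IsPadicSquare p x := by
  obtain ⟨v, m₀, rfl, hm₀⟩ := Int.exists_eq_prime_pow_mul hp hx₀
  refine ⟨v + 1, fun x hx => ?_⟩
  obtain ⟨y, hy⟩ := hx.symm.dvd
  have hpm : ¬ (p : ℤ) ∣ m₀ + p * y := fun hd => hm₀ ((Int.dvd_add_left ⟨y, rfl⟩).1 hd)
  rw [show x = (p : ℤ) ^ v * (m₀ + p * y) by linear_combination hy,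
    isPadicSquare_prime_pow_mul_iff hp hpm]
  rw [isPadicSquare_prime_pow_mul_iff hp hm₀] at h
  rwa [jacobiSym.mod_left' (show (m₀ + p * y) % p = m₀ % p by simp)]

/-- The nonzero classes modulo squares are open in `ℚ_[2]`. -/
theorem exists_forall_modEq_not_twoAdicClass {x₀ : ℤ} (hx₀ : x₀ ≠ 0) {r s : ℤ} (hr : Odd r)
    (hs : Odd s) (h₁ : ¬ TwoAdicClass r x₀) (h₂ : ¬ TwoAdicClass s x₀) :
    ∃ e : ℕ, ∀ x : ℤ, x ≡ x₀ [ZMOD 2 ^ e] →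
      x ≠ 0 ∧ ¬ TwoAdicClass r x ∧ ¬ TwoAdicClass s x := by
  obtain ⟨v, m₀, rfl, hm₀⟩ := Int.exists_eq_prime_pow_mul Nat.prime_two hx₀
  push_cast at *
  have hm₀' : Odd m₀ := by rw [Int.odd_iff]; omega
  refine ⟨v + 3, fun x hx => ?_⟩
  obtain ⟨y, hy⟩ := hx.symm.dvd
  have hm : Odd (m₀ + 8 * y) := by rw [Int.odd_iff] at hm₀' ⊢; omega
  rw [show x = 2 ^ v * (m₀ + 8 * y) by linear_combination hy,
    twoAdicClass_two_pow_mul_iff hm hr, twoAdicClass_two_pow_mul_iff hm hs]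
  rw [twoAdicClass_two_pow_mul_iff hm₀' hr] at h₁
  rw [twoAdicClass_two_pow_mul_iff hm₀' hs] at h₂
  rw [show (m₀ + 8 * y) % 8 = m₀ % 8 by omega]
  refine ⟨mul_ne_zero (by positivity) fun h0 => ?_, h₁, h₂⟩
  rw [h0] at hm
  simp at hm

theorem exists_not_isPadicSquare_binary {p : ℕ} (hp : p.Prime) (hp2 : p ≠ 2) {a b : ℤ}
    (ha : a ≠ 0) (hb : b ≠ 0) :
    ∃ u v : ℕ, a * u ^ 2 + b * v ^ 2 ≠ 0 ∧ ¬ IsPadicSquare p (a * u ^ 2 + b * v ^ 2) := by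
  by_cases hsa : IsPadicSquare p a
  swap
  · exact ⟨1, 0, by simpa, by simpa⟩
  by_cases hsb : IsPadicSquare p b
  swap
  · exact ⟨0, 1, by simpa, by simpa⟩
  obtain ⟨k, m, rfl, hm⟩ := hsa
  obtain ⟨l, n, rfl, hn⟩ := hsb
  have := Fact.mk hp
  obtain ⟨w, hw⟩ := exists_jacobiSym_eq_neg_one hp hp2
  obtain ⟨s, hs⟩ := ZMod.isSquare_of_jacobiSym_eq_one hm
  obtain ⟨t, ht⟩ := ZMod.isSquare_of_jacobiSym_eq_one hn
  have hs0 : s ≠ 0 := by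
    rintro rfl
    rw [mul_zero, ZMod.intCast_zmod_eq_zero_iff_dvd] at hs
    exact not_dvd_of_jacobiSym_ne_zero hp (by rw [hm]; exact one_ne_zero) hs
  have ht0 : t ≠ 0 := by
    rintro rfl
    rw [mul_zero, ZMod.intCast_zmod_eq_zero_iff_dvd] at ht
    exact not_dvd_of_jacobiSym_ne_zero hp (by rw [hn]; exact one_ne_zero) ht
  obtain ⟨x, y, hxy⟩ := ZMod.sq_add_sq p (w : ZMod p)
  have hj : jacobiSym (m * ((x / s).val : ℤ) ^ 2 + n * ((y / t).val : ℤ) ^ 2) p = -1 := by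
    rw [← hw]
    apply jacobiSym.mod_left'
    refine (ZMod.intCast_eq_intCast_iff _ _ _).1 ?_
    push_cast
    rw [ZMod.natCast_zmod_val, ZMod.natCast_zmod_val, hs, ht, ← hxy]
    field_simp
  have hnd := not_dvd_of_jacobiSym_ne_zero hp (by rw [hj]; norm_num)
  have hp0 : (p : ℤ) ≠ 0 := by exact_mod_cast hp.ne_zero
  refine ⟨p ^ l * (x / s).val, p ^ k * (y / t).val, ?_⟩
  push_cast
  rw [show (p : ℤ) ^ (2 * k) * m * ((p : ℤ) ^ l * (x / s).val) ^ 2 +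
      (p : ℤ) ^ (2 * l) * n * ((p : ℤ) ^ k * (y / t).val) ^ 2 =
    (p : ℤ) ^ (2 * (k + l)) * (m * ((x / s).val : ℤ) ^ 2 + n * ((y / t).val : ℤ) ^ 2) by ring,
    isPadicSquare_prime_pow_mul_iff hp hnd, hj]
  exact ⟨mul_ne_zero (pow_ne_zero _ hp0) fun h => hnd (h ▸ dvd_zero _), by norm_num⟩

theorem exists_not_twoAdicClass_binary {a b : ℤ} (ha : a ≠ 0) (hb : b ≠ 0) :
    ∃ u v : ℕ, a * u ^ 2 + b * v ^ 2 ≠ 0 ∧ ¬ TwoAdicClass 1 (a * u ^ 2 + b * v ^ 2) ∧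
      ¬ TwoAdicClass 7 (a * u ^ 2 + b * v ^ 2) := by
  by_cases hsa : TwoAdicClass 1 a ∨ TwoAdicClass 7 a
  swap
  · rw [not_or] at hsa
    exact ⟨1, 0, by simpa, by simpa using hsa⟩
  by_cases hsb : TwoAdicClass 1 b ∨ TwoAdicClass 7 b
  swap
  · rw [not_or] at hsb
    exact ⟨0, 1, by simpa, by simpa using hsb⟩
  obtain ⟨k, m, rfl, hm⟩ : ∃ (k : ℕ) (m : ℤ), a = 2 ^ (2 * k) * m ∧ (m % 8 = 1 ∨ m % 8 = 7) := by
    rcases hsa with ⟨k, m, h, hm⟩ | ⟨k, m, h, hm⟩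
    exacts [⟨k, m, h, Or.inl hm⟩, ⟨k, m, h, Or.inr hm⟩]
  obtain ⟨l, n, rfl, hn⟩ : ∃ (k : ℕ) (m : ℤ), b = 2 ^ (2 * k) * m ∧ (m % 8 = 1 ∨ m % 8 = 7) := by
    rcases hsb with ⟨k, m, h, hm⟩ | ⟨k, m, h, hm⟩
    exacts [⟨k, m, h, Or.inl hm⟩, ⟨k, m, h, Or.inr hm⟩]
  have hodd : Odd (m + 4 * n) := by rw [Int.odd_iff]; omega
  refine ⟨2 ^ l, 2 ^ (k + 1), ?_⟩
  push_cast
  rw [show (2 : ℤ) ^ (2 * k) * m * (2 ^ l) ^ 2 + 2 ^ (2 * l) * n * (2 ^ (k + 1)) ^ 2 =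
      2 ^ (2 * (k + l)) * (m + 4 * n) by ring,
    twoAdicClass_two_pow_mul_iff hodd (by decide), twoAdicClass_two_pow_mul_iff hodd (by decide)]
  refine ⟨mul_ne_zero (by positivity) (by omega), ?_, ?_⟩ <;> omega

/-- A binary form represents integers lying outside prescribed local square classes. -/
theorem exists_binary_not_isPadicSquare {a b : ℤ} (ha : a ≠ 0) (hb : b ≠ 0) (S : Finset ℕ)
    (hS : ∀ p ∈ S, p.Prime ∧ p ≠ 2) :
    ∃ u v : ℕ, a * u ^ 2 + b * v ^ 2 ≠ 0 ∧ ¬ TwoAdicClass 1 (a * u ^ 2 + b * v ^ 2) ∧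
      ¬ TwoAdicClass 7 (a * u ^ 2 + b * v ^ 2) ∧
      ∀ p ∈ S, ¬ IsPadicSquare p (a * u ^ 2 + b * v ^ 2) := by
  have hloc : ∀ p : ℕ, ∃ u v e : ℕ, p ∈ S → ∀ x : ℤ,
      x ≡ a * u ^ 2 + b * v ^ 2 [ZMOD (p : ℤ) ^ e] → ¬ IsPadicSquare p x := by
    intro p
    by_cases hp : p ∈ S
    · obtain ⟨u, v, h0, h⟩ := exists_not_isPadicSquare_binary (hS p hp).1 (hS p hp).2 ha hb
      obtain ⟨e, he⟩ := exists_forall_modEq_not_isPadicSquare (hS p hp).1 h0 h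
      exact ⟨u, v, e, fun _ => he⟩
    · exact ⟨0, 0, 0, fun h => (hp h).elim⟩
  choose u v e hloc using hloc
  obtain ⟨u₂, v₂, h0, h1, h7⟩ := exists_not_twoAdicClass_binary ha hb
  obtain ⟨e₂, he₂⟩ := exists_forall_modEq_not_twoAdicClass h0 (by decide) (by decide) h1 h7
  have hpr : ∀ p ∈ insert 2 S, p.Prime := by
    intro p hp
    rcases Finset.mem_insert.1 hp with rfl | hp
    exacts [Nat.prime_two, (hS p hp).1]
  have crt : ∀ (w : ℕ → ℕ) (w₂ : ℕ), ∃ W : ℕ, W ≡ w₂ [MOD 2 ^ e₂] ∧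
      ∀ p ∈ S, W ≡ w p [MOD p ^ e p] := by
    intro w w₂
    obtain ⟨W, hW⟩ := Nat.chineseRemainderOfFinset (fun p => if p = 2 then w₂ else w p)
      (fun p => p ^ if p = 2 then e₂ else e p) (insert 2 S)
      (fun p hp => pow_ne_zero _ (hpr p hp).ne_zero) (fun p hp q hq hpq =>
        Nat.Coprime.pow _ _ ((Nat.coprime_primes (hpr p hp) (hpr q hq)).2 hpq))
    refine ⟨W, by simpa using hW 2 (Finset.mem_insert_self _ _), fun p hp => ?_⟩
    simpa [(hS p hp).2] using hW p (Finset.mem_insert_of_mem hp)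
  obtain ⟨U, hU₂, hU⟩ := crt u u₂
  obtain ⟨V, hV₂, hV⟩ := crt v v₂
  have hmod : ∀ {k x y x' y' : ℕ}, x ≡ x' [MOD k] → y ≡ y' [MOD k] →
      a * x ^ 2 + b * y ^ 2 ≡ a * x' ^ 2 + b * y' ^ 2 [ZMOD k] := fun hx hy =>
    (((Int.natCast_modEq_iff.2 hx).pow 2).mul_left a).add
      (((Int.natCast_modEq_iff.2 hy).pow 2).mul_left b)
  obtain ⟨k0, k1, k7⟩ := he₂ _ (by exact_mod_cast hmod hU₂ hV₂)
  exact ⟨U, V, k0, k1, k7, fun p hp =>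
    hloc p hp _ (by exact_mod_cast hmod (hU p hp) (hV p hp))⟩

theorem TwoAdicClass.mul {r s m n : ℤ} (hm : TwoAdicClass r m) (hn : TwoAdicClass s n) :
    TwoAdicClass (r * s % 8) (m * n) := by
  obtain ⟨k, m, rfl, rfl⟩ := hm
  obtain ⟨l, n, rfl, rfl⟩ := hn
  exact ⟨k + l, m * n, by ring, Int.mul_emod _ _ _⟩

theorem TwoAdicClass.neg {n : ℤ} (h : TwoAdicClass 1 n) : TwoAdicClass 7 (-n) := by
  obtain ⟨k, m, rfl, hm⟩ := h
  exact ⟨k, -m, by ring, by omega⟩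

theorem TwoAdicClass.of_sq_mul {r q n : ℤ} (hr : Odd r) (hq : q ≠ 0) (hn : n ≠ 0)
    (h : TwoAdicClass r (q ^ 2 * n)) : TwoAdicClass r n := by
  obtain ⟨k, u, rfl, hu⟩ := Int.exists_eq_prime_pow_mul Nat.prime_two hq
  obtain ⟨l, m, rfl, hm⟩ := Int.exists_eq_prime_pow_mul Nat.prime_two hn
  push_cast at *
  have hu' : Odd u := by rw [Int.odd_iff]; omega
  have hm' : Odd m := by rw [Int.odd_iff]; omega
  rw [show ((2 : ℤ) ^ k * u) ^ 2 * (2 ^ l * m) = 2 ^ (2 * k + l) * (u ^ 2 * m) by ring,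
    twoAdicClass_two_pow_mul_iff (hu'.pow.mul hm') hr, Int.mul_emod,
    show u ^ 2 % 8 = 1 by have := Int.eight_dvd_sq_sub_one_of_odd hu'; omega] at h
  rw [twoAdicClass_two_pow_mul_iff hm' hr]
  refine ⟨by simpa [Nat.even_add] using h.1, by simpa using h.2⟩

theorem not_twoAdicClass_one_neg_one : ¬ TwoAdicClass 1 (-1) := by
  have := twoAdicClass_two_pow_mul_iff (v := 0) (m := -1) (r := 1) (by decide) (by decide)
  rw [pow_zero, one_mul] at this
  rw [this]
  norm_num

theorem exists_rotation_not_twoAdicClass {a b c t : ℤ} (ha : a ≠ 0) (hb : b ≠ 0) (hc : c ≠ 0)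
    (ht : t ≠ 0) (h : ¬ TwoAdicClass 7 (-(a * b * c) * t)) :
    (¬ TwoAdicClass 1 (-(a * b)) ∧ ¬ TwoAdicClass 1 (c * t)) ∨
    (¬ TwoAdicClass 1 (-(b * c)) ∧ ¬ TwoAdicClass 1 (a * t)) ∨
    (¬ TwoAdicClass 1 (-(c * a)) ∧ ¬ TwoAdicClass 1 (b * t)) := by
  have hmul : ∀ {x y z : ℤ} (q n : ℤ), q ≠ 0 → n ≠ 0 → x * y * z = q ^ 2 * n →
      TwoAdicClass 1 x → TwoAdicClass 1 y → TwoAdicClass 1 z → TwoAdicClass 1 n :=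
    fun q n hq hn e hx hy hz => by
      have := (hx.mul hy).mul hz
      rw [e] at this
      exact TwoAdicClass.of_sq_mul (by decide) hq hn this
  have hne : a * b * c * t ≠ 0 := by positivity
  have h1 : ¬ TwoAdicClass 1 (a * b * c * t) := fun h1 => h (by simpa using h1.neg)
  have h2 := not_twoAdicClass_one_neg_one
  by_contra! hcon
  obtain ⟨hA, hB, hC⟩ := hcon
  by_cases hA' : TwoAdicClass 1 (-(a * b)) <;> by_cases hB' : TwoAdicClass 1 (-(b * c)) <;>
    by_cases hC' : TwoAdicClass 1 (-(c * a))
  · exact h2 (hmul (a * b * c) (-1) (by positivity) (by norm_num) (by ring) hA' hB' hC')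
  · exact h1 (hmul b _ hb hne (by ring) hA' hB' (hC hC'))
  · exact h1 (hmul a _ ha hne (by ring) hA' (hB hB') hC')
  · exact h2 (hmul (a * b * t) (-1) (by positivity) (by norm_num) (by ring) hA' (hB hB') (hC hC'))
  · exact h1 (hmul c _ hc hne (by ring) (hA hA') hB' hC')
  · exact h2 (hmul (b * c * t) (-1) (by positivity) (by norm_num) (by ring) (hA hA') hB' (hC hC'))
  · exact h2 (hmul (a * c * t) (-1) (by positivity) (by norm_num) (by ring) (hA hA') (hB hB') hC')
  · exact h1 (hmul t _ ht hne (by ring) (hA hA') (hB hB') (hC hC'))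

/-- A quaternary form representing zero because its discriminant is a nonsquare at the relevant
primes. -/
theorem exists_quaternary_eq_of_not_twoAdicClass {a b c t : ℤ} (ha : 0 < a) (hb : 0 < b)
    (hc : 0 < c) (ht : 0 < t)
    (hS : ∀ p : ℕ, p.Prime → p ≠ 2 → (p : ℤ) ∣ a * b * c → ¬ IsPadicSquare p (-(a * b * c) * t))
    (h₁ : ¬ TwoAdicClass 1 (-(a * b))) (h₂ : ¬ TwoAdicClass 1 (c * t))
    (h₁₂ : ¬ TwoAdicClass 1 (-(a * b * c) * t)) :
    ∃ x y z w : ℤ, (x ≠ 0 ∨ y ≠ 0 ∨ z ≠ 0 ∨ w ≠ 0) ∧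
      a * x ^ 2 + b * y ^ 2 + c * z ^ 2 = t * w ^ 2 := by
  have hd : -(a * b) * (c * t) = -(a * b * c) * t := by ring
  have hd₁ : -(a * b) ≠ 0 := neg_ne_zero.2 (by positivity)
  have hd₂ : c * t ≠ 0 := by positivity
  obtain ⟨T, hT, hTp⟩ := exists_pos_forall_tameSymbol_eq_one hd₁ hd₂ ha.ne' ht.ne' (by
    intro p hp hp2
    by_cases hpx : IsPadicSquare p (-(a * b) * (c * t))
    swap
    · exact exists_tameSymbol_eq_one hp hp2 hd₁ hd₂ ha.ne' ht.ne' hpx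
    rw [hd] at hpx
    have hpabc : ¬ (p : ℤ) ∣ a * b * c := fun h => hS p hp hp2 h hpx
    have hpa : ¬ (p : ℤ) ∣ a := fun h => hpabc ((h.mul_right b).mul_right c)
    have hpab : ¬ (p : ℤ) ∣ -(a * b) := fun h => hpabc ((dvd_neg.1 h).mul_right c)
    have hpc : ¬ (p : ℤ) ∣ c := fun h => hpabc (h.mul_left _)
    have hpp := Nat.prime_iff_prime_int.1 hp
    obtain ⟨k, m, rfl, hm⟩ := Int.exists_eq_prime_pow_mul hp ht.ne'
    have hk : Even k := by
      rw [show -(a * b * c) * ((p : ℤ) ^ k * m) = (p : ℤ) ^ k * (-(a * b * c) * m) by ring,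
        isPadicSquare_prime_pow_mul_iff hp
          (fun h => (hpp.dvd_or_dvd h).elim (fun h => hpabc (dvd_neg.1 h)) hm)] at hpx
      exact hpx.1
    refine ⟨0, 1, hp.one_lt.ne' ∘ Nat.dvd_one.1, ?_, ?_⟩
    · simpa using tameSymbol_of_not_dvd hp hpa hpab
    · have := tameSymbol_of_even hp hk hk hm
        (fun h => (hpp.dvd_or_dvd h).elim hpc hm : ¬ (p : ℤ) ∣ c * m)
      rw [show (p : ℤ) ^ k * (c * m) = c * ((p : ℤ) ^ k * m) by ring] at this
      simpa using this) h₁ h₂ (by rwa [hd])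
  obtain ⟨x, y, z, hne, hxyz⟩ := exists_sq_eq_of_tameSymbol_eq_one (a * T) (-(a * b))
    (by positivity) hd₁ (Or.inl (by positivity)) fun p hp hp2 => (hTp p hp hp2).1
  obtain ⟨x', y', z', hne', hxyz'⟩ := exists_sq_eq_of_tameSymbol_eq_one (t * T) (c * t)
    (by positivity) hd₂ (Or.inl (by positivity)) fun p hp hp2 => (hTp p hp hp2).2
  have hx : x ≠ 0 := by
    rintro rfl
    have h0 : z ^ 2 + a * b * y ^ 2 = 0 := by linear_combination hxyz
    have hy : y = 0 := by
      by_contra hy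
      have : 0 < a * b * y ^ 2 := by positivity
      nlinarith [sq_nonneg z]
    subst hy
    have hz : z = 0 := by simpa using h0
    simp [hz] at hne
  refine ⟨z * t * x', a * y * t * x', t * y' * a * x, z' * a * x, ?_, ?_⟩
  · by_contra! h
    obtain ⟨-, -, h3, h4⟩ := h
    have hy' : y' = 0 := by simpa [ha.ne', ht.ne', hx] using h3
    have hz' : z' = 0 := by simpa [ha.ne', hx] using h4
    subst hy' hz'
    have hx' : x' = 0 := by simpa [ht.ne', hT.ne'] using hxyz'.symm
    simp [hx'] at hne'
  · linear_combination (a * t ^ 2 * x' ^ 2) * hxyz - (a ^ 2 * x ^ 2 * t) * hxyz'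

/-- **Meyer's theorem** for diagonal quinary forms with three positive coefficients. -/
theorem exists_quinary_eq {a b c d e : ℤ} (ha : 0 < a) (hb : 0 < b) (hc : 0 < c) (hd : 0 < d)
    (he : 0 < e) : ∃ x y z u v : ℤ, (x ≠ 0 ∨ y ≠ 0 ∨ z ≠ 0 ∨ u ≠ 0 ∨ v ≠ 0) ∧
      a * x ^ 2 + b * y ^ 2 + c * z ^ 2 = d * u ^ 2 + e * v ^ 2 := by
  have habc : a * b * c ≠ 0 := by positivity
  obtain ⟨u, v, h0, h1, h7, hS⟩ := exists_binary_not_isPadicSquare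
    (mul_ne_zero (neg_ne_zero.2 habc) hd.ne') (mul_ne_zero (neg_ne_zero.2 habc) he.ne')
    ((a * b * c).natAbs.primeFactors.erase 2) (fun p hp => by
      rw [Finset.mem_erase, Nat.mem_primeFactors] at hp
      exact ⟨hp.2.1, hp.1⟩)
  obtain ⟨t, ht⟩ : ∃ t : ℤ, t = d * u ^ 2 + e * v ^ 2 := ⟨_, rfl⟩
  rw [show -(a * b * c) * d * u ^ 2 + -(a * b * c) * e * v ^ 2 = -(a * b * c) * t by
    rw [ht]; ring] at *
  have ht0 : 0 < t := lt_of_le_of_ne (by rw [ht]; positivity) (right_ne_zero_of_mul h0).symm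
  have hS' : ∀ p : ℕ, p.Prime → p ≠ 2 → (p : ℤ) ∣ a * b * c →
      ¬ IsPadicSquare p (-(a * b * c) * t) := fun p hp hp2 h => hS p (by
    rw [Finset.mem_erase, Nat.mem_primeFactors]
    exact ⟨hp2, hp, Int.natCast_dvd.1 h, Int.natAbs_ne_zero.2 habc⟩)
  obtain ⟨x, y, z, w, hne, h⟩ : ∃ x y z w : ℤ, (x ≠ 0 ∨ y ≠ 0 ∨ z ≠ 0 ∨ w ≠ 0) ∧
      a * x ^ 2 + b * y ^ 2 + c * z ^ 2 = t * w ^ 2 := by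
    have hbca : b * c * a = a * b * c := by ring
    have hcab : c * a * b = a * b * c := by ring
    rcases exists_rotation_not_twoAdicClass ha.ne' hb.ne' hc.ne' ht0.ne' h7 with
      ⟨h2, h3⟩ | ⟨h2, h3⟩ | ⟨h2, h3⟩
    · exact exists_quaternary_eq_of_not_twoAdicClass ha hb hc ht0 hS' h2 h3 h1
    · obtain ⟨y, z, x, w, hne, h⟩ := exists_quaternary_eq_of_not_twoAdicClass hb hc ha ht0
        (by rwa [hbca]) h2 h3 (by rwa [hbca])
      exact ⟨x, y, z, w, by tauto, by linear_combination h⟩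
    · obtain ⟨z, x, y, w, hne, h⟩ := exists_quaternary_eq_of_not_twoAdicClass hc ha hb ht0
        (by rwa [hcab]) h2 h3 (by rwa [hcab])
      exact ⟨x, y, z, w, by tauto, by linear_combination h⟩
  refine ⟨x, y, z, u * w, v * w, ?_, by rw [h, ht]; ring⟩
  by_cases hw : w = 0
  · tauto
  · by_cases hu : (u : ℤ) = 0
    · have hv : (v : ℤ) ≠ 0 := by
        intro hv
        simp [hu, hv] at ht
        omega
      simp [hw, Nat.cast_ne_zero.1 hv]
    · simp [hw, Nat.cast_ne_zero.1 hu]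

/-- A symmetric bilinear form on a rational vector space has orthogonal families of integral norm
of every size up to the dimension. -/
theorem LinearMap.BilinForm.exists_orthogonal_int {V : Type*} [AddCommGroup V] [Module ℚ V]
    [FiniteDimensional ℚ V] {B : LinearMap.BilinForm ℚ V} (hB : ∀ u v, B u v = B v u)
    (W : Submodule ℚ V) {k : ℕ} (hk : k ≤ finrank ℚ W) :
    ∃ e : Fin k → V, (∀ i, e i ∈ W ∧ e i ≠ 0 ∧ ∃ m : ℤ, B (e i) (e i) = m) ∧
      ∀ i j, i ≠ j → B (e i) (e j) = 0 := by
  have : Invertible (2 : ℚ) := invertibleOfNonzero two_ne_zero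
  obtain ⟨v, hv⟩ := LinearMap.BilinForm.exists_orthogonal_basis (B := B.restrict W)
    ⟨fun x y => by simpa using hB x y⟩
  refine ⟨fun i => ((B (v (Fin.castLE hk i)) (v (Fin.castLE hk i))).den : ℚ) •
    (v (Fin.castLE hk i) : V), fun i => ⟨W.smul_mem _ (Subtype.mem _), ?_, ?_⟩, ?_⟩
  · refine smul_ne_zero (by exact_mod_cast Rat.den_ne_zero _) ?_
    simpa using v.ne_zero (Fin.castLE hk i)
  · set x : V := ((v (Fin.castLE hk i) : W) : V)
    refine ⟨(B x x).den * (B x x).num, ?_⟩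
    simp only [map_smul, LinearMap.smul_apply, smul_eq_mul]
    push_cast
    rw [← Rat.den_mul_eq_num]
  · intro i j hij
    have := hv ((Fin.castLE_injective hk).ne hij)
    simp only [Function.onFun, LinearMap.BilinForm.restrict_apply,
      LinearMap.domRestrict_apply] at this
    simp [this]

/-- consequence of Meyer's theorem: a quadratic space over `ℚ` of signature
`(n,2)` with `n ≥ 3` (expressed by an orthogonal decomposition `V = P ⊞ N` with `P` positive
definite of dimension `n` and `N` negative definite of dimension 2, so the form is
indefinite of rank `n + 2 ≥ 5`) is isotropic: it contains a nonzero vector `x` with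
`Q(x) = B(x,x)/2 = 0`. -/
theorem stmt_19 (V : Type*) [AddCommGroup V] [Module ℚ V] [FiniteDimensional ℚ V]
    (n : ℕ) (hn : 3 ≤ n)
    (B : LinearMap.BilinForm ℚ V) (hsym : ∀ u v, B u v = B v u)
    (hdim : finrank ℚ V = n + 2)
    (hsig : ∃ P N : Submodule ℚ V,
      (∀ v ∈ P, v ≠ 0 → 0 < B v v) ∧ (∀ v ∈ N, v ≠ 0 → B v v < 0) ∧
      (∀ p ∈ P, ∀ q ∈ N, B p q = 0) ∧
      finrank ℚ P = n ∧ finrank ℚ N = 2 ∧ P ⊔ N = ⊤) :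
    ∃ x : V, x ≠ 0 ∧ B x x = 0 := by
  obtain ⟨P, N, hP, hN, hPN, hPn, hN2, -⟩ := hsig
  obtain ⟨f, hf, hfo⟩ := LinearMap.BilinForm.exists_orthogonal_int hsym P (hn.trans_eq hPn.symm)
  obtain ⟨g, hg, hgo⟩ := LinearMap.BilinForm.exists_orthogonal_int hsym N hN2.ge
  choose hfP hf0 m hm using hf
  choose hgN hg0 l hl using hg
  have hm0 : ∀ i, 0 < m i := fun i => by exact_mod_cast (hm i) ▸ hP _ (hfP i) (hf0 i)
  have hl0 : ∀ i, 0 < -l i := fun i => by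
    have : (l i : ℚ) < 0 := (hl i) ▸ hN _ (hgN i) (hg0 i)
    exact neg_pos.2 (by exact_mod_cast this)
  have hfg : ∀ i j, B (f i) (g j) = 0 := fun i j => hPN _ (hfP i) _ (hgN j)
  have hgf : ∀ i j, B (g j) (f i) = 0 := fun i j => by rw [hsym, hfg]
  obtain ⟨x, y, z, u, v, hne, h⟩ :=
    exists_quinary_eq (hm0 0) (hm0 1) (hm0 2) (hl0 0) (hl0 1)
  have h : (m 0 * x ^ 2 + m 1 * y ^ 2 + m 2 * z ^ 2 : ℚ) = -l 0 * u ^ 2 + -l 1 * v ^ 2 := by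
    exact_mod_cast h
  have hf01 := hfo 0 1 (by decide)
  have hf02 := hfo 0 2 (by decide)
  have hf10 := hfo 1 0 (by decide)
  have hf12 := hfo 1 2 (by decide)
  have hf20 := hfo 2 0 (by decide)
  have hf21 := hfo 2 1 (by decide)
  have hg01 := hgo 0 1 (by decide)
  have hg10 := hgo 1 0 (by decide)
  obtain ⟨w, hw⟩ : ∃ w : V,
    w = (x : ℚ) • f 0 + (y : ℚ) • f 1 + (z : ℚ) • f 2 + (u : ℚ) • g 0 + (v : ℚ) • g 1 := ⟨_, rfl⟩
  have hf' : B w (f 0) = x * m 0 ∧ B w (f 1) = y * m 1 ∧ B w (f 2) = z * m 2 := by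
    simp [hw, hf10, hf20, hf01, hf21, hf02, hf12, hgf, hm]
  have hg' : B w (g 0) = u * l 0 ∧ B w (g 1) = v * l 1 := by
    simp [hw, hg01, hg10, hfg, hl]
  refine ⟨w, fun h0 => ?_, ?_⟩
  · have hmne : ∀ i, (m i : ℚ) ≠ 0 := fun i => by exact_mod_cast (hm0 i).ne'
    have hlne : ∀ i, (l i : ℚ) ≠ 0 := fun i => by exact_mod_cast (neg_pos.1 (hl0 i)).ne
    rw [h0] at hf' hg'
    simp [hmne, hlne] at hf' hg'
    tauto
  · have hww := congrArg (B w) hw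
    simp only [map_add, map_smul, smul_eq_mul, hf', hg'] at hww
    rw [hww]
    linear_combination h
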